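/- Let P be Markovian to a DAG G_0 on V and suppose: (1) P is adjacency faithful with respect to G_0; (2) P satisfies ordered upward stability and ordered downward stability with respect to G_0; and (3) P is V-stable. Then every DAG G with sk(G) = sk(P) such that P satisfies ordered upward stability and ordered downward stability with respect to G is Markov equivalent to G_0. -/

import Mathlib

open MeasureTheory ProbabilityTheory

/-- A directed acyclic graph on vertex set `V`: a directed edge relation with no
directed cycles (a directed path from a node to itself). -/
structure DAG (V : Type*) where
  Edge : V → V → Prop
  acyclic : ∀ i, ¬ Relation.TransGen Edge i i

namespace DAG

variable {V : Type*}

/-- `i` and `j` are adjacent if there is a directed edge between them in either direction. -/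
def Adj (G : DAG V) (i j : V) : Prop := G.Edge i j ∨ G.Edge j i

/-- `an_G(C)`: the set of nodes not in `C` with a directed path to some node of `C`. -/
def ancestors (G : DAG V) (C : Set V) : Set V :=
  {i | i ∉ C ∧ ∃ j ∈ C, Relation.TransGen G.Edge i j}

/-- A path between `a` and `b` in (the skeleton of) a DAG `G`: a sequence of at least two
distinct vertices starting at `a`, ending at `b`, with consecutive vertices adjacent. -/
structure Path (G : DAG V) (a b : V) where
  n : ℕ
  npos : 0 < n
  f : Fin (n + 1) → V
  first : f 0 = a
  last : f (Fin.last n) = b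
  adj : ∀ i : Fin n, G.Adj (f i.castSucc) (f i.succ)
  inj : Function.Injective f

/-- The intermediate node at position `t` of the path is a collider on the path:
both incident edges of the path point into it. -/
def Path.ColliderAt {G : DAG V} {a b : V} (π : Path G a b) (t : ℕ)
    (h1 : 0 < t) (h2 : t < π.n) : Prop :=
  G.Edge (π.f ⟨t - 1, by omega⟩) (π.f ⟨t, by omega⟩) ∧
  G.Edge (π.f ⟨t + 1, by omega⟩) (π.f ⟨t, by omega⟩)

/-- A path is blocked by `C` if some intermediate non-collider on the path lies in `C`,
or some collider `m` on the path satisfies `m ∉ C ∪ an_G(C)`. -/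
def Path.Blocked {G : DAG V} {a b : V} (π : Path G a b) (C : Set V) : Prop :=
  ∃ (t : ℕ) (h1 : 0 < t) (h2 : t < π.n),
    (¬ π.ColliderAt t h1 h2 ∧ π.f ⟨t, by omega⟩ ∈ C) ∨
    (π.ColliderAt t h1 h2 ∧ π.f ⟨t, by omega⟩ ∉ C ∪ G.ancestors C)

/-- d-separation: every path between a node of `A` and a node of `B` is blocked by `C`. -/
def dSep (G : DAG V) (A B C : Set V) : Prop :=
  ∀ a ∈ A, ∀ b ∈ B, ∀ π : Path G a b, π.Blocked C

/-- Two DAGs are Markov equivalent if they have exactly the same d-separations. -/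
def MarkovEquiv (G₁ G₂ : DAG V) : Prop :=
  ∀ A B C : Set V, Disjoint A B → Disjoint A C → Disjoint B C →
    (G₁.dSep A B C ↔ G₂.dSep A B C)

/-- A v-configuration `i ∼ k ∼ j` in the DAG: `i, k, j` distinct, `i` and `j` each
adjacent to `k`, but `i` and `j` not adjacent. -/
def VConfig (G : DAG V) (i k j : V) : Prop :=
  i ≠ j ∧ i ≠ k ∧ j ≠ k ∧ G.Adj i k ∧ G.Adj j k ∧ ¬ G.Adj i j

/-- A collider v-configuration `i → k ← j`. -/
def IsCollider (G : DAG V) (i k j : V) : Prop :=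
  G.VConfig i k j ∧ G.Edge i k ∧ G.Edge j k

/-- A non-collider v-configuration. -/
def IsNonCollider (G : DAG V) (i k j : V) : Prop :=
  G.VConfig i k j ∧ ¬ (G.Edge i k ∧ G.Edge j k)

end DAG

/-- A v-configuration `i ∼ k ∼ j` in an undirected graph given by an adjacency relation. -/
def VConfigRel {V : Type*} (A : V → V → Prop) (i k j : V) : Prop :=
  i ≠ j ∧ i ≠ k ∧ j ≠ k ∧ A i k ∧ A j k ∧ ¬ A i j

section Prob

variable {V : Type*} {Ω : Type*} [MeasurableSpace Ω] [StandardBorelSpace Ω] [Nonempty Ω]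
  {E : V → Type*} [∀ i, MeasurableSpace (E i)]

/-- `A ⫫ B | C`: the families `(X i)_{i ∈ A}` and `(X j)_{j ∈ B}` are conditionally
independent given the σ-algebra generated by `(X k)_{k ∈ C}`, under `μ`. -/
def CI (μ : Measure Ω) [IsFiniteMeasure μ] (X : ∀ i, Ω → E i)
    (hX : ∀ i, Measurable (X i)) (A B C : Set V) : Prop :=
  CondIndepFun (MeasurableSpace.comap (fun ω => fun k : C => X k.1 ω) inferInstance)
    ((measurable_pi_iff.mpr fun k : C => hX k.1).comap_le)
    (fun ω => fun i : A => X i.1 ω) (fun ω => fun j : B => X j.1 ω) μ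

variable (μ : Measure Ω) [IsFiniteMeasure μ] (X : ∀ i, Ω → E i) (hX : ∀ i, Measurable (X i))

/-- The skeleton of `P`: distinct `i, j` are adjacent iff no `C ⊆ V \ {i,j}` renders
`{i} ⫫ {j} | C`. -/
def SkP (i j : V) : Prop :=
  i ≠ j ∧ ¬ ∃ C : Set V, C ⊆ ({i, j} : Set V)ᶜ ∧ CI μ X hX {i} {j} C

/-- `P` is Markovian to `G`: every d-separation implies the corresponding
conditional independence. -/
def MarkovTo (G : DAG V) : Prop :=
  ∀ A B C : Set V, Disjoint A B → Disjoint A C → Disjoint B C →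
    G.dSep A B C → CI μ X hX A B C

/-- Adjacency faithfulness: adjacent nodes of `G` are separated by no conditioning set. -/
def AdjFaithful (G : DAG V) : Prop :=
  ∀ i j : V, G.Adj i j → ¬ ∃ C : Set V, C ⊆ ({i, j} : Set V)ᶜ ∧ CI μ X hX {i} {j} C

/-- `sk(P) = sk(G)`. -/
def SkelEq (G : DAG V) : Prop :=
  ∀ i j : V, G.Adj i j ↔ SkP μ X hX i j

/-- V-ordered upward stability wrt `G`. -/
def VOUS (G : DAG V) : Prop :=
  ∀ i k j : V, G.IsNonCollider i k j → ∀ C : Set V, C ⊆ ({i, j, k} : Set V)ᶜ →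
    CI μ X hX {i} {j} C → CI μ X hX {i} {j} (C ∪ {k})

/-- Collider-stability wrt `G`. -/
def ColliderStable (G : DAG V) : Prop :=
  ∀ i k j : V, G.IsCollider i k j →
    ∃ C : Set V, C ⊆ ({i, j, k} : Set V)ᶜ ∧ CI μ X hX {i} {j} C

/-- V-stability of `P`. -/
def VStable : Prop :=
  ∀ i k j : V, VConfigRel (SkP μ X hX) i k j → ∀ C : Set V, C ⊆ ({i, j, k} : Set V)ᶜ →
    ¬ (CI μ X hX {i} {j} C ∧ CI μ X hX {i} {j} (C ∪ {k}))

/-- The orientation rule assigns the v-configuration `i ∼ k ∼ j` of `sk(P)` to be a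
collider. -/
def AssignedCollider (i k j : V) : Prop :=
  VConfigRel (SkP μ X hX) i k j ∧
  ∃ C : Set V, C ⊆ ({i, j, k} : Set V)ᶜ ∧
    CI μ X hX {i} {j} C ∧ ¬ CI μ X hX {i} {j} (C ∪ {k})

/-- The orientation rule assigns the v-configuration `i ∼ k ∼ j` of `sk(P)` to be a
non-collider. -/
def AssignedNonCollider (i k j : V) : Prop :=
  VConfigRel (SkP μ X hX) i k j ∧
  ∀ C : Set V, C ⊆ ({i, j} : Set V)ᶜ → CI μ X hX {i} {j} C → k ∈ C

/-- A DAG `G` satisfies the V-OUS and collider-stable orientation rule wrt `P`. -/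
def SatisfiesRule (G : DAG V) : Prop :=
  SkelEq μ X hX G ∧
  (∀ i k j : V, AssignedCollider μ X hX i k j → G.IsCollider i k j) ∧
  (∀ i k j : V, AssignedNonCollider μ X hX i k j → G.IsNonCollider i k j)

/-- Modified V-stability: any two DAGs `G` with `sk(G) = sk(P)` to which `P` is V-OUS and
collider-stable are Markov equivalent. -/
def ModifiedVStable : Prop :=
  ∀ G₁ G₂ : DAG V,
    SkelEq μ X hX G₁ → VOUS μ X hX G₁ → ColliderStable μ X hX G₁ →
    SkelEq μ X hX G₂ → VOUS μ X hX G₂ → ColliderStable μ X hX G₂ →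
    DAG.MarkovEquiv G₁ G₂

/-- Ordered upward stability wrt `G`. -/
def OUS (G : DAG V) : Prop :=
  ∀ i j k : V, i ≠ j → i ≠ k → j ≠ k → k ∈ G.ancestors {i, j} →
    ∀ C : Set V, C ⊆ ({i, j, k} : Set V)ᶜ →
      CI μ X hX {i} {j} C → CI μ X hX {i} {j} (C ∪ {k})

/-- Ordered downward stability wrt `G`. -/
def ODS (G : DAG V) : Prop :=
  ∀ i j k : V, i ≠ j → i ≠ k → j ≠ k →
    ∀ C : Set V, C ⊆ ({i, j, k} : Set V)ᶜ → k ∉ G.ancestors ({i, j} ∪ C) →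
      CI μ X hX {i} {j} (C ∪ {k}) → CI μ X hX {i} {j} C

end Prob

namespace DAG

variable {V : Type*}

theorem Edge.asymm {G : DAG V} {i j : V} (h : G.Edge i j) : ¬ G.Edge j i := fun h' =>
  G.acyclic i (.tail (.single h) h')

theorem Adj.ne {G : DAG V} {i j : V} (h : G.Adj i j) : i ≠ j := by
  rintro rfl
  exact h.elim (fun h => G.acyclic _ (.single h)) fun h => G.acyclic _ (.single h)

theorem Adj.symm {G : DAG V} {i j : V} (h : G.Adj i j) : G.Adj j i := Or.symm h

theorem Adj.edge_of_edge_of_edge {G : DAG V} {x y z : V} (h : G.Adj x z) (hxy : G.Edge x y)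
    (hyz : G.Edge y z) : G.Edge x z :=
  h.resolve_right fun hzx => G.acyclic x (.tail (.tail (.single hxy) hyz) hzx)

/-- The ancestral closure `C ∪ an_G(C)`. -/
def closure (G : DAG V) (C : Set V) : Set V := {i | ∃ c ∈ C, Relation.ReflTransGen G.Edge i c}

theorem mem_closure_iff {G : DAG V} {C : Set V} {i : V} :
    i ∈ G.closure C ↔ i ∈ C ∪ G.ancestors C := by
  constructor
  · rintro ⟨c, hc, h⟩
    by_cases hi : i ∈ C
    · exact .inl hi
    · rcases Relation.reflTransGen_iff_eq_or_transGen.1 h with rfl | h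
      · exact (hi hc).elim
      · exact .inr ⟨hi, c, hc, h⟩
  · rintro (hi | ⟨-, c, hc, h⟩)
    · exact ⟨i, hi, .refl⟩
    · exact ⟨c, hc, h.to_reflTransGen⟩

theorem Edge.mem_closure {G : DAG V} {C : Set V} {i j : V} (h : G.Edge i j)
    (hj : j ∈ G.closure C) : i ∈ G.closure C :=
  let ⟨c, hc, hjc⟩ := hj
  ⟨c, hc, .head h hjc⟩

/-- The middle node of the triple `x, k, y` does not block given `C`. -/
def Open (G : DAG V) (C : Set V) (x k y : V) : Prop :=
  ((G.Edge x k ∧ G.Edge y k) ∧ k ∈ G.closure C) ∨ (¬ (G.Edge x k ∧ G.Edge y k) ∧ k ∉ C)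

/-- `w 0, …, w n` is a walk from `a` to `b`, possibly with repetitions, that is not blocked
by `C`. -/
structure Active (G : DAG V) (C : Set V) (a b : V) (n : ℕ) (w : ℕ → V) : Prop where
  first : w 0 = a
  last : w n = b
  adj : ∀ t < n, G.Adj (w t) (w (t + 1))
  isOpen : ∀ t, t + 1 < n → G.Open C (w t) (w (t + 1)) (w (t + 2))

/-- Removing the steps `p + 1, …, p + s` from an active walk. -/
theorem Active.cut {G : DAG V} {C : Set V} {a b : V} {n : ℕ} {w : ℕ → V}
    (h : G.Active C a b n w) (p s : ℕ) (hps : p + s ≤ n)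
    (hend : p + s = n → w p = w n)
    (hadj : p + s < n → G.Adj (w p) (w (p + s + 1)))
    (hleft : ∀ r, r + 1 = p → p + s < n → G.Open C (w r) (w p) (w (p + s + 1)))
    (hright : p + s + 1 < n → G.Open C (w p) (w (p + s + 1)) (w (p + s + 2))) :
    G.Active C a b (n - s) (fun t => if t ≤ p then w t else w (t + s)) where
  first := by simp [h.first]
  last := by
    rw [← h.last]
    by_cases hp : n - s ≤ p
    · rw [if_pos hp, show n - s = p by omega]
      exact hend (by omega)
    · rw [if_neg hp]
      congr 1
      omega
  adj t ht := by
    rcases lt_trichotomy t p with htp | rfl | htp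
    · rw [if_pos htp.le, if_pos (by omega)]
      exact h.adj t (by omega)
    · rw [if_pos le_rfl, if_neg (by omega), show t + 1 + s = t + s + 1 by omega]
      exact hadj (by omega)
    · rw [if_neg (by omega), if_neg (by omega), show t + 1 + s = t + s + 1 by omega]
      exact h.adj _ (by omega)
  isOpen t ht := by
    by_cases h1 : t + 2 ≤ p
    · rw [if_pos (by omega), if_pos (by omega), if_pos h1]
      exact h.isOpen t (by omega)
    by_cases h2 : t + 1 = p
    · rw [if_pos (by omega), if_pos (by omega), if_neg h1, h2,
        show t + 2 + s = p + s + 1 by omega]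
      exact hleft t h2 (by omega)
    by_cases h3 : t = p
    · subst h3
      rw [if_pos (by omega), if_neg (by omega), if_neg h1,
        show t + 1 + s = t + s + 1 by omega, show t + 2 + s = t + s + 2 by omega]
      exact hright (by omega)
    · rw [if_neg (by omega), if_neg (by omega), if_neg h1,
        show t + 1 + s = t + s + 1 by omega, show t + 2 + s = t + s + 2 by omega]
      exact h.isOpen _ (by omega)

/-- Leaving a node along an outgoing edge, an active walk stays directed until it meets a
collider. -/
theorem Active.transGen_or_mem_closure {G : DAG V} {C : Set V} {a b : V} {n : ℕ} {w : ℕ → V}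
    (h : G.Active C a b n w) {p : ℕ} (hp : G.Edge (w p) (w (p + 1))) (r : ℕ) (hr : p + r < n) :
    (Relation.TransGen G.Edge (w p) (w (p + r + 1)) ∧ G.Edge (w (p + r)) (w (p + r + 1))) ∨
      w p ∈ G.closure C := by
  induction r with
  | zero => exact .inl ⟨.single hp, hp⟩
  | succ r ih =>
    rcases ih (by omega) with ⟨h1, h2⟩ | h1
    · rcases h.adj (p + r + 1) (by omega) with h3 | h3
      · exact .inl ⟨h1.tail h3, h3⟩
      · rcases h.isOpen (p + r) (by omega) with ⟨-, c, hc, hk⟩ | ⟨hk, -⟩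
        · exact .inr ⟨c, hc, h1.to_reflTransGen.trans hk⟩
        · exact (hk ⟨h2, h3⟩).elim
    · exact .inr h1

/-- No active walk between the same nodes is shorter. -/
def IsShortest (G : DAG V) (C : Set V) (a b : V) (n : ℕ) : Prop :=
  ∀ m w, G.Active C a b m w → n ≤ m

theorem Active.injOn {G : DAG V} {C : Set V} {a b : V} {n : ℕ} {w : ℕ → V}
    (h : G.Active C a b n w) (hmin : G.IsShortest C a b n) {p q : ℕ} (hpq : p < q)
    (hq : q ≤ n) : w p ≠ w q := by
  intro heq
  obtain ⟨s, rfl⟩ := Nat.exists_eq_add_of_le hpq.le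
  have := hmin _ _ (h.cut p s hq (fun e => by rw [heq, e]) (fun hlt => heq ▸ h.adj _ hlt) ?_
    (fun hlt => heq ▸ h.isOpen _ hlt))
  · omega
  rintro r rfl hlt
  obtain ⟨s, rfl⟩ : ∃ s', s = s' + 1 := ⟨s - 1, by omega⟩
  have o1 := h.isOpen r (by omega)
  have o2 := h.isOpen (r + 1 + s) (by omega)
  have e1 : w (r + 1 + s + 1) = w (r + 1) := heq.symm
  rw [e1] at o2
  change G.Open C (w r) (w (r + 1)) (w (r + 1 + s + 2))
  by_cases hcol : G.Edge (w r) (w (r + 1)) ∧ G.Edge (w (r + 1 + s + 2)) (w (r + 1))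
  · refine .inl ⟨hcol, ?_⟩
    rcases o1 with ⟨-, o1⟩ | ⟨o1, -⟩
    · exact o1
    rcases o2 with ⟨-, o2⟩ | ⟨o2, -⟩
    · exact o2
    have hout : G.Edge (w (r + 1)) (w (r + 1 + 1)) :=
      (h.adj (r + 1) (by omega)).resolve_right fun e => o1 ⟨hcol.1, e⟩
    refine (h.transGen_or_mem_closure hout s (by omega)).resolve_left fun hh => ?_
    exact G.acyclic _ (e1 ▸ hh.1)
  · refine .inr ⟨hcol, fun hC => ?_⟩
    rcases o1 with ⟨o1, -⟩ | ⟨-, o1⟩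
    · rcases o2 with ⟨o2, -⟩ | ⟨-, o2⟩
      · exact hcol ⟨o1.1, o2.2⟩
      · exact o2 hC
    · exact o1 hC

/-- On a shortest active walk, the middle node of a shielded triple has an edge into an
adjacent collider of the walk. -/
theorem Active.shielded {G : DAG V} {C : Set V} {a b : V} {n : ℕ} {w : ℕ → V}
    (h : G.Active C a b n w) (hmin : G.IsShortest C a b n) {p : ℕ} (hp : p + 1 < n)
    (hadj : G.Adj (w p) (w (p + 2))) :
    (G.Edge (w (p + 1)) (w p) ∧ ∃ r, r + 1 = p ∧ G.Edge (w r) (w p)) ∨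
      (G.Edge (w (p + 1)) (w (p + 2)) ∧ p + 2 < n ∧ G.Edge (w (p + 3)) (w (p + 2))) := by
  by_contra! hno
  obtain ⟨no1, no2⟩ := hno
  have hk := h.isOpen p hp
  have a1 := h.adj p (by omega)
  have a2 := h.adj (p + 1) (by omega)
  have := hmin _ _ (h.cut p 1 (by omega) (fun e => by omega) (fun _ => hadj) ?_ ?_)
  · omega
  · rintro r rfl -
    have o := h.isOpen r (by omega)
    change G.Open C (w r) (w (r + 1)) (w (r + 1 + 2))
    rcases hadj with e | e
    · refine .inr ⟨fun hc => e.asymm hc.2, ?_⟩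
      rcases o with ⟨o, -⟩ | ⟨-, o⟩
      · exact (no1 o.2 r rfl o.1).elim
      · exact o
    · by_cases hku : G.Edge (w (r + 1 + 1)) (w (r + 1))
      · rcases o with ⟨o, o'⟩ | ⟨o, o'⟩
        · exact .inl ⟨⟨o.1, e⟩, o'⟩
        · exact .inr ⟨fun hc => o ⟨hc.1, hku⟩, o'⟩
      · have huk := a1.resolve_right hku
        have hvk := (Adj.symm a2).edge_of_edge_of_edge e huk
        have hkC : w (r + 1 + 1) ∈ G.closure C := by
          rcases hk with ⟨-, hk⟩ | ⟨hk, -⟩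
          · exact hk
          · exact (hk ⟨huk, hvk⟩).elim
        have huC := huk.mem_closure hkC
        rcases o with ⟨o, -⟩ | ⟨-, o⟩
        · exact (hku o.2).elim
        · by_cases hc : G.Edge (w r) (w (r + 1)) ∧ G.Edge (w (r + 1 + 2)) (w (r + 1))
          · exact .inl ⟨hc, huC⟩
          · exact .inr ⟨hc, o⟩
  · intro hlt
    have o := h.isOpen (p + 1) hlt
    change G.Open C (w p) (w (p + 2)) (w (p + 3))
    change G.Open C (w (p + 1)) (w (p + 2)) (w (p + 3)) at o
    rcases hadj with e | e
    · by_cases hkv : G.Edge (w (p + 1)) (w (p + 2))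
      · rcases o with ⟨o, o'⟩ | ⟨o, o'⟩
        · exact .inl ⟨⟨e, o.2⟩, o'⟩
        · exact .inr ⟨fun hc => o ⟨hkv, hc.2⟩, o'⟩
      · have hvk := a2.resolve_left hkv
        have huk := a1.edge_of_edge_of_edge e hvk
        have hkC : w (p + 1) ∈ G.closure C := by
          rcases hk with ⟨-, hk⟩ | ⟨hk, -⟩
          · exact hk
          · exact (hk ⟨huk, hvk⟩).elim
        have hvC := hvk.mem_closure hkC
        rcases o with ⟨o, -⟩ | ⟨-, o⟩
        · exact (hkv o.1).elim
        · by_cases hc : G.Edge (w p) (w (p + 2)) ∧ G.Edge (w (p + 3)) (w (p + 2))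
          · exact .inl ⟨hc, hvC⟩
          · exact .inr ⟨hc, o⟩
    · refine .inr ⟨fun hc => e.asymm hc.1, ?_⟩
      rcases o with ⟨o, -⟩ | ⟨-, o⟩
      · exact (no2 o.1 hlt o.2).elim
      · exact o

theorem Active.not_adj_of_collider {G : DAG V} {C : Set V} {a b : V} {n : ℕ} {w : ℕ → V}
    (h : G.Active C a b n w) (hmin : G.IsShortest C a b n) {p : ℕ} (hp : p + 1 < n)
    (hcol : G.Edge (w p) (w (p + 1)) ∧ G.Edge (w (p + 2)) (w (p + 1))) :
    ¬ G.Adj (w p) (w (p + 2)) := by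
  intro hadj
  rcases h.shielded hmin hp hadj with ⟨h1, -⟩ | ⟨h1, -⟩
  · exact hcol.1.asymm h1
  · exact hcol.2.asymm h1

/-- There is a directed walk of length `m` from the given node into `C`. -/
def ReachIn (G : DAG V) (C : Set V) : ℕ → V → Prop
  | 0, k => k ∈ C
  | m + 1, k => ∃ d, G.Edge k d ∧ ReachIn G C m d

theorem exists_reachIn {G : DAG V} {C : Set V} {k : V} (h : k ∈ G.closure C) :
    ∃ m, G.ReachIn C m k := by
  obtain ⟨c, hc, h⟩ := h
  induction h using Relation.ReflTransGen.head_induction_on with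
  | refl => exact ⟨0, hc⟩
  | head e _ ih => exact ⟨ih.choose + 1, _, e, ih.choose_spec⟩

/-- The length of a shortest directed walk into `C` (zero if there is none). -/
noncomputable def dist (G : DAG V) (C : Set V) (k : V) : ℕ := sInf {m | G.ReachIn C m k}

theorem ReachIn.dist_le {G : DAG V} {C : Set V} {k : V} {m : ℕ} (h : G.ReachIn C m k) :
    G.dist C k ≤ m := Nat.sInf_le h

theorem reachIn_dist {G : DAG V} {C : Set V} {k : V} (h : k ∈ G.closure C) :
    G.ReachIn C (G.dist C k) k := Nat.sInf_mem (exists_reachIn h)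

theorem ReachIn.mem_closure {G : DAG V} {C : Set V} {k : V} {m : ℕ} (h : G.ReachIn C m k) :
    k ∈ G.closure C := by
  induction m generalizing k with
  | zero => exact ⟨k, h, .refl⟩
  | succ m ih => exact let ⟨_, e, hd⟩ := h; e.mem_closure (ih hd)

theorem exists_edge_dist {G : DAG V} {C : Set V} {k : V} (h : k ∈ G.closure C) (hk : k ∉ C) :
    ∃ d, G.Edge k d ∧ d ∈ G.closure C ∧ G.dist C k = G.dist C d + 1 := by
  have hr := reachIn_dist h
  cases hm : G.dist C k with
  | zero => exact (hk (by rwa [hm] at hr)).elim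
  | succ m =>
    rw [hm] at hr
    obtain ⟨d, e, hd⟩ := hr
    have h1 : G.ReachIn C (G.dist C d + 1) k := ⟨d, e, reachIn_dist hd.mem_closure⟩
    have h2 := h1.dist_le
    have h3 := hd.dist_le
    exact ⟨d, e, hd.mem_closure, by omega⟩

/-- The two DAGs have the same skeleton and the same collider v-configurations. -/
structure SamePattern (G H : DAG V) : Prop where
  adj : ∀ i j, G.Adj i j ↔ H.Adj i j
  collider : ∀ i k j, G.VConfig i k j →
    (G.Edge i k ∧ G.Edge j k ↔ H.Edge i k ∧ H.Edge j k)

theorem SamePattern.symm {G H : DAG V} (h : SamePattern G H) : SamePattern H G where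
  adj i j := (h.adj i j).symm
  collider i k j hv := (h.collider i k j (by simpa only [VConfig, h.adj] using hv)).symm

/-- An unshielded edge out of the head of a common edge is common. -/
theorem SamePattern.edge {G H : DAG V} (h : SamePattern G H) {y k d : V} (e₁ : G.Edge y k)
    (e₂ : H.Edge y k) (hd : G.Edge k d) (hyd : ¬ G.Adj y d) : H.Edge k d := by
  have hv : G.VConfig y k d := by
    refine ⟨?_, Adj.ne (.inl e₁), Adj.ne (.inr hd), .inl e₁, .inr hd, hyd⟩
    rintro rfl
    exact e₁.asymm hd
  refine ((h.adj k d).1 (.inl hd)).resolve_right fun e => ?_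
  exact hd.asymm ((h.collider y k d hv).2 ⟨e₂, e⟩).2

theorem SamePattern.mem_closure_of_dist {G H : DAG V} (h : SamePattern G H) {C : Set V} (m : ℕ)
    {y k : V} (e₁ : G.Edge y k) (e₂ : H.Edge y k) (hk : k ∈ G.closure C)
    (hm : G.dist C k = m) (hy : G.dist C y = m + 1) : k ∈ H.closure C := by
  induction m generalizing y k with
  | zero => exact ⟨k, by simpa [hm, ReachIn] using reachIn_dist hk, .refl⟩
  | succ m ih =>
    by_cases hkC : k ∈ C
    · exact ⟨k, hkC, .refl⟩
    obtain ⟨d, hd, hdC, hdist⟩ := exists_edge_dist hk hkC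
    have hdH : H.Edge k d := by
      refine h.edge e₁ e₂ hd fun hyd => ?_
      have : G.ReachIn C (G.dist C d + 1) y :=
        ⟨d, hyd.edge_of_edge_of_edge e₁ hd, reachIn_dist hdC⟩
      have := this.dist_le
      omega
    exact hdH.mem_closure (ih hd hdH hdC (by omega) hm)

/-- Replacing a collider by a common child of its neighbours preserves activity. -/
theorem Active.update {G : DAG V} {C : Set V} {a b : V} {n : ℕ} {w : ℕ → V}
    (h : G.Active C a b n w) {p : ℕ} (hp : p + 1 < n) {d : V}
    (h1 : G.Edge (w p) (w (p + 1))) (h2 : G.Edge (w (p + 2)) (w (p + 1)))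
    (hd1 : G.Edge (w p) d) (hd2 : G.Edge (w (p + 2)) d) (hd : d ∈ G.closure C) :
    G.Active C a b n (Function.update w (p + 1) d) where
  first := by rw [Function.update_of_ne (by omega), h.first]
  last := by rw [Function.update_of_ne (by omega), h.last]
  adj t ht := by
    by_cases c1 : t = p
    · subst c1
      rw [Function.update_of_ne (by omega), Function.update_self]
      exact .inl hd1
    by_cases c2 : t = p + 1
    · subst c2
      rw [Function.update_self, Function.update_of_ne (by omega)]
      exact .inr hd2
    · rw [Function.update_of_ne c2, Function.update_of_ne (by omega)]
      exact h.adj t ht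
  isOpen t ht := by
    have o := h.isOpen t ht
    by_cases c1 : t = p
    · subst c1
      rw [Function.update_of_ne (by omega), Function.update_self,
        Function.update_of_ne (by omega)]
      exact .inl ⟨⟨hd1, hd2⟩, hd⟩
    by_cases c2 : t = p + 1
    · subst c2
      rw [Function.update_self, Function.update_of_ne (by omega),
        Function.update_of_ne (by omega)]
      refine .inr ⟨fun hc => hd2.asymm hc.1, ?_⟩
      rcases o with ⟨o, -⟩ | ⟨-, o⟩
      · exact (h2.asymm o.1).elim
      · exact o
    by_cases c3 : t + 1 = p
    · subst c3
      rw [Function.update_of_ne (by omega), Function.update_of_ne (by omega),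
        Function.update_self]
      refine .inr ⟨fun hc => hd1.asymm hc.2, ?_⟩
      rcases o with ⟨o, -⟩ | ⟨-, o⟩
      · exact (h1.asymm o.2).elim
      · exact o
    · rw [Function.update_of_ne c2, Function.update_of_ne (by omega),
        Function.update_of_ne (by omega)]
      exact o

/-- A shortest active walk whose nodes have least total distance to `C` remains active in every
DAG with the same pattern. -/
theorem Active.transfer {G H : DAG V} (hGH : SamePattern G H) {C : Set V} {a b : V} {n : ℕ}
    {w : ℕ → V} (h : G.Active C a b n w) (hmin : G.IsShortest C a b n)
    (hsum : ∀ w', G.Active C a b n w' →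
      ∑ t ∈ Finset.range n, G.dist C (w t) ≤ ∑ t ∈ Finset.range n, G.dist C (w' t)) :
    H.Active C a b n w where
  first := h.first
  last := h.last
  adj t ht := (hGH.adj _ _).1 (h.adj t ht)
  isOpen t ht := by
    have vconfig : ∀ t, t + 1 < n → ¬ G.Adj (w t) (w (t + 2)) →
        G.VConfig (w t) (w (t + 1)) (w (t + 2)) := fun t ht hn =>
      ⟨h.injOn hmin (by omega) (by omega), h.injOn hmin (by omega) (by omega),
        (h.injOn hmin (by omega) (by omega)).symm, h.adj t (by omega),
        (h.adj (t + 1) (by omega)).symm, hn⟩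
    have transfer_collider : ∀ t, t + 1 < n →
        G.Edge (w t) (w (t + 1)) ∧ G.Edge (w (t + 2)) (w (t + 1)) →
        H.Edge (w t) (w (t + 1)) ∧ H.Edge (w (t + 2)) (w (t + 1)) := fun t ht hc =>
      (hGH.collider _ _ _ (vconfig t ht (h.not_adj_of_collider hmin ht hc))).1 hc
    rcases h.isOpen t ht with ⟨hc, hk⟩ | ⟨hc, hk⟩
    · have hcH := transfer_collider t ht hc
      refine .inl ⟨hcH, ?_⟩
      by_cases hkC : w (t + 1) ∈ C
      · exact ⟨_, hkC, .refl⟩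
      obtain ⟨d, hd, hdC, hdist⟩ := exists_edge_dist hk hkC
      have hdH : H.Edge (w (t + 1)) d := by
        by_cases hu : G.Adj (w t) d
        · refine hGH.edge hc.2 hcH.2 hd fun hv => ?_
          have := hsum _ (h.update ht hc.1 hc.2 (hu.edge_of_edge_of_edge hc.1 hd)
            (hv.edge_of_edge_of_edge hc.2 hd) hdC)
          refine this.not_gt (Finset.sum_lt_sum (fun s _ => ?_)
            ⟨t + 1, Finset.mem_range.2 ht, ?_⟩)
          · by_cases hs : s = t + 1
            · subst hs
              rw [Function.update_self]
              omega
            · rw [Function.update_of_ne hs]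
          · rw [Function.update_self]
            omega
        · exact hGH.edge hc.1 hcH.1 hd hu
      exact hdH.mem_closure (hGH.mem_closure_of_dist _ hd hdH hdC rfl hdist)
    · refine .inr ⟨fun hcH => ?_, hk⟩
      by_cases hs : G.Adj (w t) (w (t + 2))
      · rcases h.shielded hmin ht hs with ⟨h1, r, rfl, h2⟩ | ⟨h1, hlt, h2⟩
        · exact hcH.1.asymm (transfer_collider r (by omega) ⟨h2, h1⟩).2
        · exact hcH.2.asymm (transfer_collider (t + 1) hlt ⟨h1, h2⟩).1
      · exact hc ((hGH.collider _ _ _ (vconfig t ht hs)).2 hcH)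

theorem Path.exists_active {G : DAG V} {C : Set V} {a b : V} (π : Path G a b)
    (h : ¬ π.Blocked C) :
    ∃ w, G.Active C a b π.n w ∧ ∀ p q, p < q → q ≤ π.n → w p ≠ w q := by
  refine ⟨fun t => if ht : t < π.n + 1 then π.f ⟨t, ht⟩ else a, ⟨?_, ?_, fun t ht => ?_,
    fun t ht => ?_⟩, fun p q hpq hq heq => ?_⟩
  · simpa using π.first
  · simpa [Fin.last] using π.last
  · rw [dif_pos (by omega), dif_pos (by omega)]
    exact π.adj ⟨t, ht⟩
  · rw [dif_pos (by omega), dif_pos (by omega), dif_pos (by omega)]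
    by_cases hc : π.ColliderAt (t + 1) (by omega) ht
    · refine .inl ⟨hc, mem_closure_iff.2 ?_⟩
      by_contra hk
      exact h ⟨t + 1, by omega, ht, .inr ⟨hc, hk⟩⟩
    · exact .inr ⟨hc, fun hk => h ⟨t + 1, by omega, ht, .inl ⟨hc, hk⟩⟩⟩
  · dsimp only at heq
    rw [dif_pos (by omega), dif_pos (by omega)] at heq
    have := congrArg Fin.val (π.inj heq)
    simp only at this
    omega

theorem Active.exists_path {G : DAG V} {C : Set V} {a b : V} {n : ℕ} {w : ℕ → V}
    (h : G.Active C a b n w) (hn : 0 < n) (hinj : ∀ p q, p < q → q ≤ n → w p ≠ w q) :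
    ∃ π : Path G a b, ¬ π.Blocked C := by
  refine ⟨⟨n, hn, fun t => w t, h.first, h.last, fun t => h.adj t t.2, fun s t hst => ?_⟩, ?_⟩
  · rcases lt_trichotomy (s : ℕ) t with hlt | heq | hlt
    · exact (hinj _ _ hlt (by omega) hst).elim
    · exact Fin.ext heq
    · exact (hinj _ _ hlt (by omega) hst.symm).elim
  · rintro ⟨t, h1, h2, hb⟩
    obtain ⟨t, rfl⟩ : ∃ s, t = s + 1 := ⟨t - 1, by omega⟩
    have o := h.isOpen t h2
    rcases hb with ⟨hc, hk⟩ | ⟨hc, hk⟩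
    · rcases o with ⟨o, -⟩ | ⟨-, o⟩
      · exact hc o
      · exact o hk
    · rcases o with ⟨-, o⟩ | ⟨o, -⟩
      · exact hk (mem_closure_iff.1 o)
      · exact o hc

theorem SamePattern.exists_path {G H : DAG V} (hGH : SamePattern G H) {C : Set V} {a b : V}
    (hab : a ≠ b) (π : Path G a b) (hπ : ¬ π.Blocked C) :
    ∃ π' : Path H a b, ¬ π'.Blocked C := by
  classical
  have hex : ∃ n, ∃ w, G.Active C a b n w :=
    ⟨_, (π.exists_active hπ).imp fun _ => And.left⟩
  have hmin : G.IsShortest C a b (Nat.find hex) := fun m w hw => Nat.find_min' hex ⟨w, hw⟩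
  obtain ⟨w, hw, hsum⟩ := WellFounded.has_min
    (measure fun w : ℕ → V => ∑ t ∈ Finset.range (Nat.find hex), G.dist C (w t)).wf
    {w | G.Active C a b (Nat.find hex) w} (Nat.find_spec hex)
  have hH := hw.transfer hGH hmin fun w' hw' => not_lt.1 (hsum w' hw')
  refine hH.exists_path (Nat.pos_of_ne_zero fun h0 => hab ?_) fun p q hpq hq =>
    hw.injOn hmin hpq hq
  rw [← hw.first, ← hw.last, h0]

/-- DAGs with the same skeleton and the same collider v-configurations are Markov
equivalent. -/
theorem SamePattern.markovEquiv {G H : DAG V} (h : SamePattern G H) : MarkovEquiv G H := by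
  have key : ∀ {G H : DAG V}, SamePattern G H → ∀ {A B C : Set V}, Disjoint A B →
      H.dSep A B C → G.dSep A B C := by
    intro G H h A B C hAB hsep a ha b hb π
    by_contra hπ
    obtain ⟨π', hπ'⟩ := h.exists_path (hAB.ne_of_mem ha hb) π hπ
    exact hπ' (hsep a ha b hb π')
  exact fun A B C hAB _ _ => ⟨key h.symm hAB, key h hAB⟩

/-- Non-adjacent nodes are d-separated by their ancestors. -/
theorem dSep_ancestors {G : DAG V} {i j : V} (hadj : ¬ G.Adj i j) :
    G.dSep {i} {j} (G.ancestors {i, j}) := by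
  rintro _ rfl _ rfl π
  by_contra hπ
  obtain ⟨w, h, hinj⟩ := π.exists_active hπ
  have hpos := π.npos
  generalize π.n = n at h hinj hpos
  obtain ⟨rfl, rfl⟩ : w 0 = _ ∧ w n = _ := ⟨h.first, h.last⟩
  have hn : 1 < n := by
    by_contra hn
    obtain rfl : n = 1 := by omega
    exact hadj (h.adj 0 hpos)
  have mem : ∀ t, 0 < t → t < n → ∀ e ∈ ({w 0, w n} : Set V),
      Relation.TransGen G.Edge (w t) e → w t ∈ G.ancestors {w 0, w n} := by
    refine fun t h0 ht e he hte => ⟨?_, e, he, hte⟩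
    rintro (h1 | h1)
    · exact hinj 0 t h0 ht.le h1.symm
    · exact hinj t n ht le_rfl h1
  have closure_sub : ∀ x ∈ G.closure (G.ancestors {w 0, w n}),
      ∃ e ∈ ({w 0, w n} : Set V), Relation.TransGen G.Edge x e := by
    rintro x ⟨c, ⟨-, e, he, hce⟩, hxc⟩
    exact ⟨e, he, .trans_right hxc hce⟩
  rcases h.isOpen 0 hn with ⟨hc, hk⟩ | ⟨hc, hk⟩
  · obtain ⟨e, he, hk⟩ := closure_sub _ hk
    obtain rfl : e = w n := he.resolve_left fun he => G.acyclic _ (.head hc.1 (he ▸ hk))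
    have h2 : Relation.TransGen G.Edge (w 2) (w n) := .head hc.2 hk
    have hn2 : 2 < n := by
      by_contra hn2
      obtain rfl : n = 2 := by omega
      exact G.acyclic _ h2
    rcases h.isOpen 1 hn2 with ⟨o, -⟩ | ⟨-, o⟩
    · exact hc.2.asymm o.1
    · exact o (mem 2 (by omega) hn2 _ (.inr rfl) h2)
  · refine hk ?_
    by_cases e0 : G.Edge (w 1) (w 0)
    · exact mem 1 one_pos hn _ (.inl rfl) (.single e0)
    · have e0 : G.Edge (w 0) (w 1) := (h.adj 0 hpos).resolve_right e0
      have e1 : G.Edge (w 1) (w 2) := (h.adj 1 hn).resolve_right fun e => hc ⟨e0, e⟩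
      obtain ⟨r, rfl⟩ : ∃ r, n = 1 + r + 1 := ⟨n - 2, by omega⟩
      rcases h.transGen_or_mem_closure e1 r (by omega) with ⟨ht, -⟩ | ht
      · exact mem 1 one_pos hn _ (.inr rfl) ht
      · obtain ⟨e, he, ht⟩ := closure_sub _ ht
        exact mem 1 one_pos hn e he ht

end DAG

section Prob

variable {V : Type*} {Ω : Type*} [MeasurableSpace Ω] [StandardBorelSpace Ω]
  {E : V → Type*} [∀ i, MeasurableSpace (E i)] {μ : Measure Ω} [IsFiniteMeasure μ]
  {X : ∀ i, Ω → E i} {hX : ∀ i, Measurable (X i)}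

theorem skelEq_of_markovTo {G : DAG V} (hM : MarkovTo μ X hX G) (hA : AdjFaithful μ X hX G) :
    SkelEq μ X hX G := by
  refine fun i j => ⟨fun h => ⟨h.ne, hA i j h⟩, fun ⟨hij, h⟩ => ?_⟩
  by_contra hadj
  have hdisj : ∀ e ∈ ({i, j} : Set V), Disjoint {e} (G.ancestors {i, j}) := fun e he =>
    Set.disjoint_singleton_left.2 fun h => h.1 he
  exact h ⟨G.ancestors {i, j}, fun _ hk => hk.1, hM _ _ _ (by simpa using hij)
    (hdisj i (.inl rfl)) (hdisj j (.inr rfl)) (DAG.dSep_ancestors hadj)⟩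

theorem SkelEq.vConfigRel {G : DAG V} (hG : SkelEq μ X hX G) {i k j : V}
    (h : G.VConfig i k j) : VConfigRel (SkP μ X hX) i k j := by
  simpa only [VConfigRel, DAG.VConfig, hG _ _] using h

theorem OUS.mem_of_isNonCollider {G : DAG V} (hG : SkelEq μ X hX G) (hO : OUS μ X hX G)
    (hV : VStable μ X hX) {i k j : V} (h : G.IsNonCollider i k j) {C : Set V}
    (hC : C ⊆ ({i, j} : Set V)ᶜ) (hCI : CI μ X hX {i} {j} C) : k ∈ C := by
  by_contra hk
  obtain ⟨hv, hnc⟩ := h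
  have hC' : C ⊆ ({i, j, k} : Set V)ᶜ := by
    rintro c hc (rfl | rfl | rfl)
    · exact hC hc (.inl rfl)
    · exact hC hc (.inr rfl)
    · exact hk hc
  refine hV i k j (hG.vConfigRel hv) C hC' ⟨hCI, ?_⟩
  obtain ⟨hij, hik, hjk, aik, ajk, -⟩ := hv
  refine hO i j k hij hik hjk ⟨?_, ?_⟩ C hC' hCI
  · rintro (rfl | rfl)
    · exact hik rfl
    · exact hjk rfl
  · rcases aik with h1 | h1
    · exact ⟨j, .inr rfl, .single (ajk.resolve_left fun h2 => hnc ⟨h1, h2⟩)⟩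
    · exact ⟨i, .inl rfl, .single h1⟩

theorem ODS.notMem_of_isCollider [Finite V] {G : DAG V} (hG : SkelEq μ X hX G)
    (hO : ODS μ X hX G) (hV : VStable μ X hX) {i k j : V} (h : G.IsCollider i k j) {C : Set V}
    (hC : C ⊆ ({i, j} : Set V)ᶜ) (hCI : CI μ X hX {i} {j} C) : k ∉ C := by
  intro hk
  induction hm : C.ncard using Nat.strong_induction_on generalizing C with
  | _ m ih =>
  subst hm
  obtain ⟨hv, hi, hj⟩ := h
  have : IsTrans V (fun x y => Relation.TransGen G.Edge y x) := ⟨fun _ _ _ h1 h2 => h2.trans h1⟩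
  have : Std.Irrefl (fun x y => Relation.TransGen G.Edge y x) := ⟨G.acyclic⟩
  obtain ⟨c, ⟨hcC, hkc⟩, hmax⟩ := (Finite.wellFounded_of_trans_of_irrefl
    fun x y => Relation.TransGen G.Edge y x).has_min
    {c | c ∈ C ∧ Relation.ReflTransGen G.Edge k c} ⟨k, hk, .refl⟩
  have hanc : c ∉ G.ancestors ({i, j} ∪ C \ {c}) := by
    rintro ⟨-, d, (rfl | rfl) | ⟨hd, -⟩, hcd⟩
    · exact G.acyclic _ (.head hi (.trans_right hkc hcd))
    · exact G.acyclic _ (.head hj (.trans_right hkc hcd))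
    · exact hmax d ⟨hd, hkc.trans hcd.to_reflTransGen⟩ hcd
  have hic : i ≠ c := fun e => hC hcC (.inl e.symm)
  have hjc : j ≠ c := fun e => hC hcC (.inr e.symm)
  have hC' : C \ {c} ⊆ ({i, j, c} : Set V)ᶜ := by
    rintro d ⟨hd, hdc⟩ (rfl | rfl | h)
    · exact hC hd (.inl rfl)
    · exact hC hd (.inr rfl)
    · exact hdc h
  have hunion : C \ {c} ∪ {c} = C := Set.sdiff_union_of_subset (by simpa using hcC)
  have hCI' := hO i j c hv.1 hic hjc _ hC' hanc (by rwa [hunion])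
  by_cases hck : c = k
  · subst hck
    exact hV i c j (hG.vConfigRel hv) _ hC' ⟨hCI', by rwa [hunion]⟩
  · exact ih _ (Set.ncard_sdiff_singleton_lt_of_mem hcC) (Set.sdiff_subset.trans hC) hCI'
      ⟨hk, fun e => hck e.symm⟩ rfl

theorem isCollider_of_isCollider [Finite V] {G H : DAG V} (hV : VStable μ X hX)
    (hG : SkelEq μ X hX G) (hGd : ODS μ X hX G) (hH : SkelEq μ X hX H) (hHu : OUS μ X hX H)
    {i k j : V} (h : G.IsCollider i k j) : H.IsCollider i k j := by
  have hv : H.VConfig i k j := by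
    simpa only [DAG.VConfig, hG _ _, hH _ _] using h.1
  refine ⟨hv, ?_⟩
  by_contra hnc
  obtain ⟨C, hC, hCI⟩ : ∃ C : Set V, C ⊆ ({i, j} : Set V)ᶜ ∧ CI μ X hX {i} {j} C := by
    by_contra hno
    exact hv.2.2.2.2.2 ((hH i j).2 ⟨hv.1, hno⟩)
  exact hGd.notMem_of_isCollider hG hV h hC hCI (hHu.mem_of_isNonCollider hH hV ⟨hv, hnc⟩ hC hCI)

theorem samePattern_of_stable [Finite V] {G H : DAG V} (hV : VStable μ X hX)
    (hG : SkelEq μ X hX G) (hGu : OUS μ X hX G) (hGd : ODS μ X hX G)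
    (hH : SkelEq μ X hX H) (hHu : OUS μ X hX H) (hHd : ODS μ X hX H) : G.SamePattern H where
  adj i j := (hG i j).trans (hH i j).symm
  collider i k j hv := by
    have hv' : H.VConfig i k j := by simpa only [DAG.VConfig, hG _ _, hH _ _] using hv
    exact ⟨fun h => (isCollider_of_isCollider hV hG hGd hH hHu ⟨hv, h⟩).2,
      fun h => (isCollider_of_isCollider hV hH hHd hG hGu ⟨hv', h⟩).2⟩

end Prob

variable {V : Type*} [Fintype V] {Ω : Type*} [MeasurableSpace Ω] [StandardBorelSpace Ω]
  [Nonempty Ω] {E : V → Type*} [∀ i, MeasurableSpace (E i)]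
  (μ : MeasureTheory.Measure Ω) [MeasureTheory.IsProbabilityMeasure μ]
  (X : ∀ i, Ω → E i) (hX : ∀ i, Measurable (X i))

/-- Consistency of natural structure learning: under adjacency faithfulness, ordered
upward/downward stability wrt `G₀`, and V-stability, every DAG `G` with `sk(G) = sk(P)`
to which `P` satisfies ordered upward and downward stability is Markov equivalent to `G₀`. -/
theorem stmt_12 (G₀ : DAG V) (hM : MarkovTo μ X hX G₀)
    (h1 : AdjFaithful μ X hX G₀)
    (h2 : OUS μ X hX G₀ ∧ ODS μ X hX G₀)
    (h3 : VStable μ X hX) :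
    ∀ G : DAG V, SkelEq μ X hX G → OUS μ X hX G → ODS μ X hX G →
      DAG.MarkovEquiv G G₀ :=
  fun _ hG hGu hGd => (samePattern_of_stable h3 hG hGu hGd (skelEq_of_markovTo hM h1)
    h2.1 h2.2).markovEquiv
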